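/- If the constructed instance admits a feasible schedule with makespan W, then it admits a feasible schedule with makespan W in normal form. Moreover, in every normal-form feasible schedule with makespan W, the number of jobs of a processed on machine 2 equals the number of jobs of γ processed on machine 2, and the number of jobs of b processed on machine 2 equals the number of jobs of δ processed on machine 2. -/

import Mathlib

/-- Jobs of the instance constructed from a 3-Partition instance with parameter `z`. -/
inductive Job (z : ℕ) : Type
  | JA (i : Fin (z+1))
  | JB (i : Fin (z+1))
  | Ja (i : Fin z)
  | Jb (i : Fin z)
  | Jc (j : Fin (z+1))
  | Jα (i : Fin z)
  | Jβ (i : Fin z)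
  | Jγ (j : Fin z)
  | Jδ (j : Fin z)
  | Jl1
  | Jl2
  | Jpart (i : Fin (3*z))
  deriving DecidableEq, Fintype

/-- Processing times of the constructed jobs (`γ_j`, `δ_j` use index `j ∈ {1,…,z}`,
represented by `j.val + 1` for `j : Fin z`). -/
def pJob (z D : ℕ) (ι : Fin (3*z) → ℕ) : Job z → ℕ
  | .JA _ => D^2
  | .JB _ => D^3
  | .Ja _ => D^4 + D^6 + 3*z*D^7
  | .Jb _ => D^5 + D^6 + 3*z*D^7
  | .Jc j => (z + j.val)*D^7 + D^8
  | .Jα _ => D^3 + D^5 + 4*z*D^7 + D^8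
  | .Jβ _ => D^2 + D^4 + (4*z-1)*D^7 + D^8
  | .Jγ j => D^5 + (3*z - (j.val+1))*D^7 - D
  | .Jδ j => D^4 + (3*z - (j.val+1))*D^7
  | .Jl1 => D^3 + z*D^7 + D^8
  | .Jl2 => D^2 + 2*z*D^7 + D^8
  | .Jpart i => ι i

/-- Machine requirements of the constructed jobs. -/
def qJob (z : ℕ) : Job z → ℕ
  | .JA _ => 3
  | .JB _ => 3
  | .Ja _ => 2
  | .Jb _ => 2
  | .Jc _ => 2
  | _ => 1

/-- Feasibility of a schedule `(σ, ρ)` on machines `{1,…,m}`: every job gets `q j`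
machines among `{1,…,m}`, and jobs sharing a machine have disjoint half-open intervals. -/
def Feasible {J : Type} (m : ℕ) (p q : J → ℕ) (σ : J → ℕ) (ρ : J → Finset ℕ) : Prop :=
  (∀ j, ρ j ⊆ Finset.Icc 1 m) ∧ (∀ j, (ρ j).card = q j) ∧
  (∀ j j', j ≠ j' → (ρ j ∩ ρ j').Nonempty →
    σ j + p j ≤ σ j' ∨ σ j' + p j' ≤ σ j)

/-- Makespan of a schedule. -/
def makespan {J : Type} [Fintype J] (p σ : J → ℕ) : ℕ :=
  Finset.univ.sup fun j => σ j + p j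

/-- The target makespan `W`. -/
def Wval (z D : ℕ) : ℕ :=
  (z+1)*(D^2 + D^3 + D^8) + z*(D^4 + D^5 + D^6) + z*(7*z+1)*D^7

/-- The 3-Partition instance `ι` is a Yes-instance. -/
def IsYes (z D : ℕ) (ι : Fin (3*z) → ℕ) : Prop :=
  ∃ f : Fin (3*z) → Fin z,
    ∀ k : Fin z, ∑ i ∈ Finset.univ.filter (fun i => f i = k), ι i = D

/-- Jobs processed on machine 1 in a normal-form schedule: `A ∪ a ∪ α ∪ {λ₁}`. -/
def M1Jobs {z : ℕ} : Job z → Prop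
  | .JA _ => True
  | .Ja _ => True
  | .Jα _ => True
  | .Jl1 => True
  | _ => False

/-- Jobs processed on machine 4 in a normal-form schedule: `B ∪ b ∪ β ∪ {λ₂}`. -/
def M4Jobs {z : ℕ} : Job z → Prop
  | .JB _ => True
  | .Jb _ => True
  | .Jβ _ => True
  | .Jl2 => True
  | _ => False

/-- Jobs processed on both machines 2 and 3: `A ∪ B ∪ c`. -/
def BothM23 {z : ℕ} : Job z → Prop
  | .JA _ => True
  | .JB _ => True
  | .Jc _ => True
  | _ => False

/-- Jobs processed on exactly one of machines 2 and 3: `a ∪ b ∪ γ ∪ δ ∪ P`. -/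
def OneM23 {z : ℕ} : Job z → Prop
  | .Ja _ => True
  | .Jb _ => True
  | .Jγ _ => True
  | .Jδ _ => True
  | .Jpart _ => True
  | _ => False

/-- Normal form of a schedule of the constructed instance. -/
def NormalForm {z : ℕ} (ρ : Job z → Finset ℕ) : Prop :=
  (∀ j, 1 ∈ ρ j ↔ M1Jobs j) ∧
  (∀ j, 4 ∈ ρ j ↔ M4Jobs j) ∧
  (∀ j, BothM23 j → 2 ∈ ρ j ∧ 3 ∈ ρ j) ∧
  (∀ j, OneM23 j → ((2 ∈ ρ j) ↔ ¬ (3 ∈ ρ j)))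

/-- `cnt p σ S i` = number of jobs of `S` finishing no later than the start of `i`
(the quantity `#ᵢ S`). -/
def cnt {z : ℕ} (p σ : Job z → ℕ) (S : Finset (Job z)) (i : Job z) : ℕ :=
  (S.filter fun j => σ j + p j ≤ σ i).card

def sA (z : ℕ) : Finset (Job z) := Finset.univ.image Job.JA
def sB (z : ℕ) : Finset (Job z) := Finset.univ.image Job.JB
def sa (z : ℕ) : Finset (Job z) := Finset.univ.image Job.Ja
def sb (z : ℕ) : Finset (Job z) := Finset.univ.image Job.Jb
def sc (z : ℕ) : Finset (Job z) := Finset.univ.image Job.Jc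
def sα (z : ℕ) : Finset (Job z) := Finset.univ.image Job.Jα
def sβ (z : ℕ) : Finset (Job z) := Finset.univ.image Job.Jβ
def sγ (z : ℕ) : Finset (Job z) := Finset.univ.image Job.Jγ
def sδ (z : ℕ) : Finset (Job z) := Finset.univ.image Job.Jδ


theorem load_le {J : Type} [Fintype J] [DecidableEq J] (W k : ℕ) (p q σ : J → ℕ) (ρ : J → Finset ℕ)
    (hf : Feasible 4 p q σ ρ) (hW : ∀ j, σ j + p j ≤ W) :
    ∑ j, (if k ∈ ρ j then p j else 0) ≤ W := by
  rw [← Finset.sum_filter]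
  have h1 : ∑ j ∈ Finset.univ.filter (fun j => k ∈ ρ j), p j
      = ((Finset.univ.filter (fun j => k ∈ ρ j)).biUnion
          (fun j => Finset.Ico (σ j) (σ j + p j))).card := by
    rw [Finset.card_biUnion]
    · simp
    · intro j hj j' hj' hne
      simp only [Finset.coe_filter, Finset.mem_univ, true_and, Set.mem_ofPred_eq] at hj hj'
      change Disjoint (Finset.Ico (σ j) (σ j + p j)) (Finset.Ico (σ j') (σ j' + p j'))
      rw [Finset.disjoint_left]
      intro t ht ht'
      simp only [Finset.mem_Ico] at ht ht'
      have := hf.2.2 j j' hne ⟨k, by simp [hj, hj']⟩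
      omega
  rw [h1]
  have h2 : ((Finset.univ.filter (fun j => k ∈ ρ j)).biUnion
          (fun j => Finset.Ico (σ j) (σ j + p j))) ⊆ Finset.range W := by
    intro t ht
    simp only [Finset.mem_biUnion, Finset.mem_Ico, Finset.mem_range] at ht ⊢
    obtain ⟨j, -, h⟩ := ht
    have := hW j
    omega
  simpa using Finset.card_le_card h2

theorem ind_sum {J : Type} (p q σ : J → ℕ) (ρ : J → Finset ℕ)
    (hf : Feasible 4 p q σ ρ) (j : J) :
    (if 1 ∈ ρ j then 1 else 0) + (if 2 ∈ ρ j then 1 else 0) + (if 3 ∈ ρ j then 1 else 0)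
      + (if 4 ∈ ρ j then 1 else 0) = q j := by
  rw [← hf.2.1 j]
  have h : (ρ j) = (Finset.Icc 1 4).filter (fun k => k ∈ ρ j) := by
    ext k
    simp only [Finset.mem_filter]
    exact ⟨fun h => ⟨hf.1 j h, h⟩, fun h => h.2⟩
  conv_rhs => rw [h]
  rw [Finset.card_filter]
  have : Finset.Icc 1 4 = ({1,2,3,4} : Finset ℕ) := by decide
  rw [this, Finset.sum_insert (by decide), Finset.sum_insert (by decide),
    Finset.sum_insert (by decide), Finset.sum_singleton]
  ring

theorem tail_swap {J : Type} (p q σ : J → ℕ) (ρ : J → Finset ℕ)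
    (hf : Feasible 4 p q σ ρ) (e : ℕ) (π : Equiv.Perm ℕ)
    (hπ : ∀ k, k ∈ Finset.Icc 1 4 → π k ∈ Finset.Icc 1 4)
    (hb : ∀ k, k ∈ Finset.Icc 1 4 → π k ≠ k → ∀ j, π k ∈ ρ j → σ j < e → σ j + p j ≤ e) :
    Feasible 4 p q σ (fun j => if σ j < e then ρ j else (ρ j).map π.toEmbedding) := by
  have key : ∀ j j', j ≠ j' → σ j < e → ¬ σ j' < e →
      (ρ j ∩ (ρ j').map π.toEmbedding).Nonempty → σ j + p j ≤ σ j' ∨ σ j' + p j' ≤ σ j := by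
    intro j j' hne h1 h2 ⟨k, hk⟩
    simp only [Finset.mem_inter, Finset.mem_map, Equiv.coe_toEmbedding] at hk
    obtain ⟨hk, k', hk', rfl⟩ := hk
    by_cases h : π k' = k'
    · exact hf.2.2 j j' hne ⟨k', by rw [h] at hk; simp [hk, hk']⟩
    · have := hb k' (hf.1 _ hk') h j hk h1
      omega
  refine ⟨?_, ?_, ?_⟩
  · intro j
    dsimp only
    split_ifs
    · exact hf.1 j
    · intro k hk
      simp only [Finset.mem_map, Equiv.coe_toEmbedding] at hk
      obtain ⟨k', hk', rfl⟩ := hk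
      exact hπ _ (hf.1 _ hk')
  · intro j
    dsimp only
    split_ifs
    · exact hf.2.1 j
    · rw [Finset.card_map]; exact hf.2.1 j
  · intro j j' hne hn
    dsimp only at hn
    split_ifs at hn with h1 h2 h2
    · exact hf.2.2 j j' hne hn
    · exact key j j' hne h1 h2 hn
    · rw [Finset.inter_comm] at hn
      exact (key j' j hne.symm h2 h1 hn).symm
    · refine hf.2.2 j j' hne ?_
      rw [← Finset.map_inter] at hn
      exact Finset.map_nonempty.1 hn

theorem three_aux {J : Type} [Fintype J] (p q σ : J → ℕ) (ρ : J → Finset ℕ)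
    (hf : Feasible 4 p q σ ρ) (hp : ∀ j, q j = 3 → 0 < p j) (t : ℕ) :
    ∃ ρ', Feasible 4 p q σ ρ' ∧ ∀ j, q j = 3 → σ j < t → 2 ∈ ρ' j ∧ 3 ∈ ρ' j := by
  classical
  induction t with
  | zero => exact ⟨ρ, hf, fun j _ h => absurd h (Nat.not_lt_zero _)⟩
  | succ t ih =>
    obtain ⟨ρ, hf, hρ⟩ := ih
    have hdisj : ∀ i j, i ≠ j → q i = 3 → q j = 3 → σ i ≤ σ j → σ i + p i ≤ σ j := by
      intro i j hne hi hj hle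
      have h1 := ind_sum p q σ ρ hf i
      have h2 := ind_sum p q σ ρ hf j
      have hn : (ρ i ∩ ρ j).Nonempty := by
        by_contra hcon
        rw [Finset.not_nonempty_iff_eq_empty] at hcon
        have hh : ∀ k, k ∈ ρ i → k ∉ ρ j := by
          intro k hk hk'
          have : k ∈ ρ i ∩ ρ j := by simp [hk, hk']
          rw [hcon] at this
          simp at this
        have a1 := hh 1
        have a2 := hh 2
        have a3 := hh 3
        have a4 := hh 4
        rw [hi] at h1
        rw [hj] at h2
        split_ifs at h1 h2 <;> first | omega | tauto
      have := hf.2.2 i j hne hn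
      have := hp j hj
      omega
    by_cases hT : ∃ T, q T = 3 ∧ σ T = t ∧ ¬ (2 ∈ ρ T ∧ 3 ∈ ρ T)
    swap
    · push Not at hT
      refine ⟨ρ, hf, fun j hj hlt => ?_⟩
      rcases Nat.lt_succ_iff_lt_or_eq.1 hlt with h | h
      · exact hρ j hj h
      · exact hT j hj h
    obtain ⟨T, hqT, hσT, hbad⟩ := hT
    have huniq : ∀ j, q j = 3 → σ j = t → j = T := by
      intro j hj hjt
      by_contra hne
      have := hdisj j T hne hj hqT (by omega)
      have := hp j hj
      omega
    -- the swap step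
    have step : ∀ e n, (n = 1 ∨ n = 4) → e ≤ t → (∀ j, q j = 3 → σ j < t → σ j < e) →
        (∀ k, k ∈ Finset.Icc 1 4 → k ≠ 5 - n → ∀ j, k ∈ ρ j → σ j < e → σ j + p j ≤ e) →
        ∃ ρ', Feasible 4 p q σ ρ' ∧ ∀ j, q j = 3 → σ j < t + 1 → 2 ∈ ρ' j ∧ 3 ∈ ρ' j := by
      intro e n hn he hpre hbr
      obtain ⟨m', hm', hm'T, hall⟩ : ∃ m', (m' = 2 ∨ m' = 3) ∧ m' ∉ ρ T ∧
          ∀ k, k ∈ Finset.Icc 1 4 → k ≠ m' → k ∈ ρ T := by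
        have h1 := ind_sum p q σ ρ hf T
        rw [hqT] at h1
        by_cases h2 : 2 ∈ ρ T
        · have h3 : 3 ∉ ρ T := fun h => hbad ⟨h2, h⟩
          refine ⟨3, Or.inr rfl, h3, ?_⟩
          intro k hk hk3
          simp only [Finset.mem_Icc] at hk
          split_ifs at h1 <;> first | omega | skip
          obtain ⟨_, _⟩ := hk
          interval_cases k <;> first | assumption | omega
        · refine ⟨2, Or.inl rfl, h2, ?_⟩
          intro k hk hk3
          simp only [Finset.mem_Icc] at hk
          split_ifs at h1 <;> first | omega | skip
          obtain ⟨_, _⟩ := hk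
          interval_cases k <;> first | assumption | omega
      refine ⟨_, tail_swap p q σ ρ hf e (Equiv.swap m' n) ?_ ?_, ?_⟩
      · intro k hk
        simp only [Finset.mem_Icc] at hk ⊢
        rw [Equiv.swap_apply_def]
        split_ifs <;> omega
      · intro k hk hne j hj hlt
        have hk1 : Equiv.swap m' n k ∈ Finset.Icc 1 4 := by
          simp only [Finset.mem_Icc] at hk ⊢
          rw [Equiv.swap_apply_def]
          split_ifs <;> omega
        refine hbr _ hk1 ?_ j hj hlt
        rw [Equiv.swap_apply_def] at hne ⊢
        split_ifs at hne ⊢ <;> omega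
      · intro j hj hlt
        rcases Nat.lt_succ_iff_lt_or_eq.1 hlt with h | h
        · rw [if_pos (hpre j hj h)]
          exact hρ j hj h
        · rw [if_neg (by omega), huniq j hj h]
          have hsym : ∀ k, k ∈ (ρ T).map (Equiv.swap m' n).toEmbedding ↔ Equiv.swap m' n k ∈ ρ T := by
            intro k
            rw [Finset.mem_map_equiv, Equiv.symm_swap]
          rw [hsym, hsym]
          constructor
          · apply hall
            · simp only [Finset.mem_Icc]
              rw [Equiv.swap_apply_def]
              split_ifs <;> omega
            · rw [Equiv.swap_apply_def]
              split_ifs <;> omega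
          · apply hall
            · simp only [Finset.mem_Icc]
              rw [Equiv.swap_apply_def]
              split_ifs <;> omega
            · rw [Equiv.swap_apply_def]
              split_ifs <;> omega
    by_cases hprev : ∃ j, q j = 3 ∧ σ j < t
    · obtain ⟨j0, hj0⟩ := hprev
      obtain ⟨T', hT', hmax⟩ := Finset.exists_max_image
        (Finset.univ.filter (fun j => q j = 3 ∧ σ j < t)) σ ⟨j0, by simp [hj0]⟩
      simp only [Finset.mem_filter, Finset.mem_univ, true_and] at hT' hmax
      have hpT' := hp T' hT'.1
      have hne : T' ≠ T := by rintro rfl; omega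
      have he := hdisj T' T hne hT'.1 hqT (by omega)
      have h23 := hρ T' hT'.1 hT'.2
      have h1 := ind_sum p q σ ρ hf T'
      rw [hT'.1] at h1
      have hcase : ∃ n, (n = 1 ∨ n = 4) ∧ ∀ k, k ∈ Finset.Icc 1 4 → k ≠ 5 - n → k ∈ ρ T' := by
        by_cases h : 1 ∈ ρ T'
        · refine ⟨1, Or.inl rfl, ?_⟩
          intro k hk hk4
          simp only [Finset.mem_Icc] at hk
          obtain ⟨_, _⟩ := hk
          interval_cases k <;> first | assumption | omega | exact h23.1 | exact h23.2
        · refine ⟨4, Or.inr rfl, ?_⟩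
          have h4 : 4 ∈ ρ T' := by
            by_contra h4
            simp [h, h4, h23] at h1
          intro k hk hk4
          simp only [Finset.mem_Icc] at hk
          obtain ⟨_, _⟩ := hk
          interval_cases k <;> first | assumption | omega | exact h23.1 | exact h23.2
      obtain ⟨n, hn, hk⟩ := hcase
      refine step (σ T' + p T') n hn (by omega) ?_ ?_
      · intro j hj hlt
        have := hmax j ⟨hj, hlt⟩
        omega
      · intro k hk1 hk2 j hkj hlt
        by_cases hjT : j = T'
        · rw [hjT]
        · have := hf.2.2 j T' hjT ⟨k, by simp [hkj, hk k hk1 hk2]⟩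
          omega
    · push Not at hprev
      refine step 0 1 (Or.inl rfl) (by omega) ?_ ?_
      · intro j hj hlt
        have := hprev j hj
        omega
      · intro k _ _ j _ h
        omega

theorem three_main {J : Type} [Fintype J] (p q σ : J → ℕ) (ρ : J → Finset ℕ)
    (hf : Feasible 4 p q σ ρ) (hp : ∀ j, q j = 3 → 0 < p j) :
    ∃ ρ', Feasible 4 p q σ ρ' ∧ ∀ j, q j = 3 → 2 ∈ ρ' j ∧ 3 ∈ ρ' j := by
  obtain ⟨ρ', h, h'⟩ := three_aux p q σ ρ hf hp (Finset.univ.sup σ + 1)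
  refine ⟨ρ', h, fun j hj => h' j hj ?_⟩
  have : σ j ≤ Finset.univ.sup σ := Finset.le_sup (Finset.mem_univ j)
  omega

def jobEquiv (z : ℕ) : Job z ≃ (Fin (z+1) ⊕ Fin (z+1) ⊕ Fin z ⊕ Fin z ⊕ Fin (z+1) ⊕ Fin z ⊕ Fin z
    ⊕ Fin z ⊕ Fin z ⊕ Unit ⊕ Unit ⊕ Fin (3*z)) where
  toFun
    | .JA i => .inl i
    | .JB i => .inr (.inl i)
    | .Ja i => .inr (.inr (.inl i))
    | .Jb i => .inr (.inr (.inr (.inl i)))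
    | .Jc i => .inr (.inr (.inr (.inr (.inl i))))
    | .Jα i => .inr (.inr (.inr (.inr (.inr (.inl i)))))
    | .Jβ i => .inr (.inr (.inr (.inr (.inr (.inr (.inl i))))))
    | .Jγ i => .inr (.inr (.inr (.inr (.inr (.inr (.inr (.inl i)))))))
    | .Jδ i => .inr (.inr (.inr (.inr (.inr (.inr (.inr (.inr (.inl i))))))))
    | .Jl1 => .inr (.inr (.inr (.inr (.inr (.inr (.inr (.inr (.inr (.inl ())))))))))
    | .Jl2 => .inr (.inr (.inr (.inr (.inr (.inr (.inr (.inr (.inr (.inr (.inl ()))))))))))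
    | .Jpart i => .inr (.inr (.inr (.inr (.inr (.inr (.inr (.inr (.inr (.inr (.inr i))))))))))
  invFun
    | .inl i => .JA i
    | .inr (.inl i) => .JB i
    | .inr (.inr (.inl i)) => .Ja i
    | .inr (.inr (.inr (.inl i))) => .Jb i
    | .inr (.inr (.inr (.inr (.inl i)))) => .Jc i
    | .inr (.inr (.inr (.inr (.inr (.inl i))))) => .Jα i
    | .inr (.inr (.inr (.inr (.inr (.inr (.inl i)))))) => .Jβ i
    | .inr (.inr (.inr (.inr (.inr (.inr (.inr (.inl i))))))) => .Jγ i
    | .inr (.inr (.inr (.inr (.inr (.inr (.inr (.inr (.inl i)))))))) => .Jδ i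
    | .inr (.inr (.inr (.inr (.inr (.inr (.inr (.inr (.inr (.inl _))))))))) => .Jl1
    | .inr (.inr (.inr (.inr (.inr (.inr (.inr (.inr (.inr (.inr (.inl _)))))))))) => .Jl2
    | .inr (.inr (.inr (.inr (.inr (.inr (.inr (.inr (.inr (.inr (.inr i)))))))))) => .Jpart i
  left_inv := by rintro (_|_|_|_|_|_|_|_|_|_|_|_) <;> rfl
  right_inv := by rintro (_|_|_|_|_|_|_|_|_|_|_|_) <;> rfl

theorem sumJob {z : ℕ} (f : Job z → ℤ) :
    ∑ j, f j = (∑ i, f (.JA i)) + ((∑ i, f (.JB i)) + ((∑ i, f (.Ja i)) + ((∑ i, f (.Jb i)) +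
      ((∑ i, f (.Jc i)) + ((∑ i, f (.Jα i)) + ((∑ i, f (.Jβ i)) + ((∑ i, f (.Jγ i)) +
      ((∑ i, f (.Jδ i)) + (f .Jl1 + (f .Jl2 + ∑ i, f (.Jpart i))))))))))) := by
  rw [← (jobEquiv z).symm.sum_comp f]
  simp only [Fintype.sum_sum_type, Finset.univ_unique, Finset.sum_singleton]
  rfl

theorem sum_id_fin (n : ℕ) : 2 * ∑ j : Fin (n+1), (j.val : ℤ) = n * (n+1) := by
  rw [Fin.sum_univ_eq_sum_range (fun j => (j : ℤ))]
  induction n with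
  | zero => simp
  | succ n ih => rw [Finset.sum_range_succ, mul_add, ih]; push_cast; ring

theorem sum_id_fin' (n : ℕ) : 2 * ∑ j : Fin n, ((j.val : ℤ) + 1) = n * (n+1) := by
  rw [Fin.sum_univ_eq_sum_range (fun j => (j : ℤ) + 1)]
  induction n with
  | zero => simp
  | succ n ih => rw [Finset.sum_range_succ, mul_add, ih]; push_cast; ring

theorem digits0 (D a b : ℤ) (hD : 0 < D) (ha : |a| < D) (h : a + D * b = 0) : a = 0 ∧ b = 0 := by
  have h1 : a = 0 := Int.eq_zero_of_abs_lt_dvd ⟨-b, by linarith⟩ ha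
  subst h1
  refine ⟨rfl, ?_⟩
  rcases mul_eq_zero.1 (by linarith : D * b = 0) with h | h
  · omega
  · exact h

theorem digits (D e0 e2 e3 e4 e5 e6 e7 e8 : ℤ) (hD : 0 < D) (h0 : |e0| < D^2)
    (h2 : |e2| < D) (h3 : |e3| < D) (h4 : |e4| < D) (h5 : |e5| < D) (h6 : |e6| < D) (h7 : |e7| < D)
    (h : e0 + e2*D^2 + e3*D^3 + e4*D^4 + e5*D^5 + e6*D^6 + e7*D^7 + e8*D^8 = 0) :
    e0 = 0 ∧ e2 = 0 ∧ e3 = 0 ∧ e4 = 0 ∧ e5 = 0 ∧ e6 = 0 ∧ e7 = 0 ∧ e8 = 0 := by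
  obtain ⟨r0, h⟩ := digits0 (D^2) e0 (e2 + D*(e3+D*(e4+D*(e5+D*(e6+D*(e7+D*e8)))))) (by positivity) h0
    (by linarith)
  obtain ⟨r2, h⟩ := digits0 D _ _ hD h2 h
  obtain ⟨r3, h⟩ := digits0 D _ _ hD h3 h
  obtain ⟨r4, h⟩ := digits0 D _ _ hD h4 h
  obtain ⟨r5, h⟩ := digits0 D _ _ hD h5 h
  obtain ⟨r6, h⟩ := digits0 D _ _ hD h6 h
  obtain ⟨r7, h⟩ := digits0 D _ _ hD h7 h
  exact ⟨r0, r2, r3, r4, r5, r6, r7, h⟩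

/-- indicator -/
def xi {z : ℕ} (ρ : Job z → Finset ℕ) (k : ℕ) (j : Job z) : ℤ := if k ∈ ρ j then 1 else 0

theorem xi_nonneg {z : ℕ} (ρ : Job z → Finset ℕ) (k : ℕ) (j : Job z) : 0 ≤ xi ρ k j := by
  unfold xi; split_ifs <;> simp

theorem xi_le {z : ℕ} (ρ : Job z → Finset ℕ) (k : ℕ) (j : Job z) : xi ρ k j ≤ 1 := by
  unfold xi; split_ifs <;> simp

/-- count of a family -/
def nn {z n : ℕ} (ρ : Job z → Finset ℕ) (F : Fin n → Job z) (k : ℕ) : ℤ := ∑ i, xi ρ k (F i)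

theorem nn_nonneg {z n : ℕ} (ρ : Job z → Finset ℕ) (F : Fin n → Job z) (k : ℕ) : 0 ≤ nn ρ F k :=
  Finset.sum_nonneg fun _ _ => xi_nonneg _ _ _

theorem nn_le {z n : ℕ} (ρ : Job z → Finset ℕ) (F : Fin n → Job z) (k : ℕ) : nn ρ F k ≤ n := by
  have : nn ρ F k ≤ ∑ _i : Fin n, 1 := Finset.sum_le_sum fun i _ => xi_le ρ k (F i)
  simpa using this

theorem nn_full {z n : ℕ} (ρ : Job z → Finset ℕ) (F : Fin n → Job z) (k : ℕ) (h : nn ρ F k = n)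
    (i : Fin n) : k ∈ ρ (F i) := by
  by_contra hc
  have : nn ρ F k < ∑ _i : Fin n, 1 :=
    Finset.sum_lt_sum (fun i _ => xi_le ρ k (F i)) ⟨i, Finset.mem_univ _, by simp [xi, hc]⟩
  simp at this
  omega

theorem nn_of_full {z n : ℕ} (ρ : Job z → Finset ℕ) (F : Fin n → Job z) (k : ℕ)
    (h : ∀ i, k ∈ ρ (F i)) : nn ρ F k = n := by
  simp [nn, xi, h]

theorem nn_of_none {z n : ℕ} (ρ : Job z → Finset ℕ) (F : Fin n → Job z) (k : ℕ)
    (h : ∀ i, k ∉ ρ (F i)) : nn ρ F k = 0 := by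
  simp [nn, xi, h]

theorem nn_zero {z n : ℕ} (ρ : Job z → Finset ℕ) (F : Fin n → Job z) (k : ℕ) (h : nn ρ F k = 0)
    (i : Fin n) : k ∉ ρ (F i) := by
  intro hc
  have := (Finset.sum_eq_zero_iff_of_nonneg (fun i _ => xi_nonneg ρ k (F i))).1 h i (Finset.mem_univ _)
  simp [xi, hc] at this

theorem wsum_bounds {z n : ℕ} (ρ : Job z → Finset ℕ) (F : Fin n → Job z) (k : ℕ) (w : Fin n → ℤ)
    (M : ℤ) (h0 : ∀ i, 0 ≤ w i) (hM : ∀ i, w i ≤ M) :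
    0 ≤ ∑ i, xi ρ k (F i) * w i ∧ ∑ i, xi ρ k (F i) * w i ≤ M * nn ρ F k := by
  constructor
  · exact Finset.sum_nonneg fun i _ => mul_nonneg (xi_nonneg _ _ _) (h0 i)
  · unfold nn
    rw [Finset.mul_sum]
    refine Finset.sum_le_sum fun i _ => ?_
    rw [mul_comm M]
    exact mul_le_mul_of_nonneg_left (hM i) (xi_nonneg _ _ _)

theorem pJob_cast {z D : ℕ} (ι : Fin (3*z) → ℕ) (hz : 0 < z) (hD : 0 < D) (j : Job z) :
    (pJob z D ι j : ℤ) = match j with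
      | .JA _ => (D:ℤ)^2
      | .JB _ => (D:ℤ)^3
      | .Ja _ => (D:ℤ)^4 + D^6 + 3*z*D^7
      | .Jb _ => (D:ℤ)^5 + D^6 + 3*z*D^7
      | .Jc j => (z + (j.val : ℤ))*D^7 + D^8
      | .Jα _ => (D:ℤ)^3 + D^5 + 4*z*D^7 + D^8
      | .Jβ _ => (D:ℤ)^2 + D^4 + (4*z-1)*D^7 + D^8
      | .Jγ j => (D:ℤ)^5 + (3*z - ((j.val:ℤ)+1))*D^7 - D
      | .Jδ j => (D:ℤ)^4 + (3*z - ((j.val:ℤ)+1))*D^7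
      | .Jl1 => (D:ℤ)^3 + z*D^7 + D^8
      | .Jl2 => (D:ℤ)^2 + 2*z*D^7 + D^8
      | .Jpart i => (ι i : ℤ) := by
  have h5 : D ≤ D^5 := Nat.le_self_pow (by norm_num) D
  cases j with
  | Jβ i => simp only [pJob]; rw [Nat.cast_add, Nat.cast_add, Nat.cast_mul, Nat.cast_sub (by omega)]; push_cast; try ring
  | Jγ j =>
    have := j.isLt
    simp only [pJob]
    rw [Nat.cast_sub (le_trans h5 (Nat.le_add_right _ _)), Nat.cast_add, Nat.cast_mul, Nat.cast_sub (by omega)]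
    push_cast; try ring
  | Jδ j =>
    have := j.isLt
    simp only [pJob]
    rw [Nat.cast_add, Nat.cast_mul, Nat.cast_sub (by omega)]
    push_cast; try ring
  | _ => simp only [pJob] <;> push_cast <;> try ring

theorem tot_work {z D : ℕ} (ι : Fin (3*z) → ℕ) (hz : 0 < z) (hD : 0 < D)
    (hsum : ∑ i, ι i = z * D) :
    ∑ j, (qJob z j : ℤ) * (pJob z D ι j : ℤ) = 4 * (Wval z D : ℤ) := by
  rw [sumJob]
  simp only [pJob_cast ι hz hD, qJob]
  have h1 := sum_id_fin z
  have h2 := sum_id_fin' z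
  have h3 : ∑ i, (ι i : ℤ) = z * D := by exact_mod_cast hsum
  simp only [← Finset.mul_sum, Finset.sum_add_distrib, Finset.sum_sub_distrib, ← Finset.sum_mul,
    Finset.sum_const, Finset.card_univ, Fintype.card_fin, nsmul_eq_mul, h3] at *
  unfold Wval
  push_cast at *
  linear_combination (D:ℤ)^7 * h1 - (D:ℤ)^7 * h2

theorem load_eq {z D : ℕ} (ι : Fin (3*z) → ℕ) (hz : 0 < z) (hD : 0 < D)
    (hsum : ∑ i, ι i = z * D) (σ : Job z → ℕ) (ρ : Job z → Finset ℕ)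
    (hf : Feasible 4 (pJob z D ι) (qJob z) σ ρ) (hm : makespan (pJob z D ι) σ = Wval z D)
    (k : ℕ) (hk : k ∈ Finset.Icc 1 4) :
    ∑ j, xi ρ k j * (pJob z D ι j : ℤ) = Wval z D := by
  have hW : ∀ j, σ j + pJob z D ι j ≤ Wval z D := by
    intro j
    rw [← hm]
    exact Finset.le_sup (f := fun j => σ j + pJob z D ι j) (Finset.mem_univ j)
  have hl : ∀ k, ∑ j, xi ρ k j * (pJob z D ι j : ℤ) ≤ Wval z D := by
    intro k
    have h := load_le _ k _ _ _ _ hf hW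
    have h' : ((∑ j, (if k ∈ ρ j then pJob z D ι j else 0) : ℕ) : ℤ) ≤ Wval z D := by exact_mod_cast h
    rw [Nat.cast_sum] at h'
    refine le_trans (le_of_eq (Finset.sum_congr rfl fun j _ => ?_)) h'
    unfold xi
    split_ifs <;> simp
  have ht := tot_work ι hz hD hsum
  have hs : ∀ j, (qJob z j : ℤ) = xi ρ 1 j + xi ρ 2 j + xi ρ 3 j + xi ρ 4 j := by
    intro j
    rw [← ind_sum _ _ _ _ hf j]
    unfold xi
    push_cast
    rfl
  simp only [hs, add_mul, Finset.sum_add_distrib] at ht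
  have := hl 1
  have := hl 2
  have := hl 3
  have := hl 4
  simp only [Finset.mem_Icc] at hk
  obtain ⟨_, _⟩ := hk
  interval_cases k <;> linarith

/-- digit equations of one machine -/
structure Eqs {z : ℕ} (D : ℕ) (ι : Fin (3*z) → ℕ) (ρ : Job z → Finset ℕ) (k : ℕ) : Prop where
  e0 : ∑ i, xi ρ k (.Jpart i) * (ι i : ℤ) = D * nn ρ .Jγ k
  e2 : nn ρ .JA k + nn ρ .Jβ k + xi ρ k .Jl2 = z + 1
  e3 : nn ρ .JB k + nn ρ .Jα k + xi ρ k .Jl1 = z + 1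
  e4 : nn ρ .Ja k + nn ρ .Jβ k + nn ρ .Jδ k = z
  e5 : nn ρ .Jb k + nn ρ .Jα k + nn ρ .Jγ k = z
  e6 : nn ρ .Ja k + nn ρ .Jb k = z
  e7 : nn ρ .Jc k = 0 → nn ρ .Jγ k = 0 → nn ρ .Jδ k = 0 →
    3*z*(nn ρ .Ja k + nn ρ .Jb k) + 4*z*nn ρ .Jα k + (4*z-1)*nn ρ .Jβ k
      + z * xi ρ k .Jl1 + 2*z*xi ρ k .Jl2 = z*(7*z+1)
  e8 : nn ρ .Jc k + nn ρ .Jα k + nn ρ .Jβ k + xi ρ k .Jl1 + xi ρ k .Jl2 = z + 1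

set_option maxHeartbeats 1000000 in
theorem eqs_main {z D : ℕ} (ι : Fin (3*z) → ℕ) (hz : 0 < z) (hDpos : 0 < D)
    (hsum : ∑ i, ι i = z * D) (hD : 4*z*(7*z+1) < D)
    (σ : Job z → ℕ) (ρ : Job z → Finset ℕ)
    (hf : Feasible 4 (pJob z D ι) (qJob z) σ ρ) (hm : makespan (pJob z D ι) σ = Wval z D)
    (k : ℕ) (hk : k ∈ Finset.Icc 1 4) : Eqs D ι ρ k := by
  have h := load_eq ι hz hDpos hsum σ ρ hf hm k hk
  rw [sumJob] at h
  simp only [pJob_cast ι hz hDpos] at h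
  have hc : ∑ i, xi ρ k (.Jc i) * (((z:ℤ) + ((i : Fin (z+1)).val : ℤ))*(D:ℤ)^7 + (D:ℤ)^8)
      = (∑ i, xi ρ k (.Jc i) * ((z:ℤ) + ((i : Fin (z+1)).val : ℤ))) * D^7 + nn ρ .Jc k * D^8 := by
    unfold nn
    rw [Finset.sum_mul, Finset.sum_mul, ← Finset.sum_add_distrib]
    exact Finset.sum_congr rfl fun _ _ => by ring
  have hg : ∑ i, xi ρ k (.Jγ i) * ((D:ℤ)^5 + (3*z - (((i : Fin z).val:ℤ)+1))*D^7 - D)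
      = (∑ i, xi ρ k (.Jγ i) * (3*z - (((i : Fin z).val:ℤ)+1))) * D^7 + nn ρ .Jγ k * (D^5 - D) := by
    unfold nn
    rw [Finset.sum_mul, Finset.sum_mul, ← Finset.sum_add_distrib]
    exact Finset.sum_congr rfl fun _ _ => by ring
  have hd : ∑ i, xi ρ k (.Jδ i) * ((D:ℤ)^4 + (3*z - (((i : Fin z).val:ℤ)+1))*D^7)
      = (∑ i, xi ρ k (.Jδ i) * (3*z - (((i : Fin z).val:ℤ)+1))) * D^7 + nn ρ .Jδ k * D^4 := by
    unfold nn
    rw [Finset.sum_mul, Finset.sum_mul, ← Finset.sum_add_distrib]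
    exact Finset.sum_congr rfl fun _ _ => by ring
  rw [hc, hg, hd] at h
  simp only [← Finset.sum_mul] at h
  have b1 := wsum_bounds ρ .Jc k (fun i : Fin (z+1) => (z:ℤ) + (i.val : ℤ)) (2*z)
    (fun i => by positivity) (fun i => by have := i.isLt; omega)
  have b2 := wsum_bounds ρ .Jγ k (fun i : Fin z => 3*z - ((i.val:ℤ)+1)) (3*z)
    (fun i => by have := i.isLt; omega) (fun i => by have := i.isLt; omega)
  have b3 := wsum_bounds ρ .Jδ k (fun i : Fin z => 3*z - ((i.val:ℤ)+1)) (3*z)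
    (fun i => by have := i.isLt; omega) (fun i => by have := i.isLt; omega)
  have b0 : 0 ≤ ∑ i, xi ρ k (.Jpart i) * (ι i : ℤ) :=
    Finset.sum_nonneg fun i _ => mul_nonneg (xi_nonneg _ _ _) (by positivity)
  have b0' : ∑ i, xi ρ k (.Jpart i) * (ι i : ℤ) ≤ z * D := by
    have : ∑ i, (ι i : ℤ) = z * D := by exact_mod_cast hsum
    rw [← this]
    refine Finset.sum_le_sum fun i _ => ?_
    exact mul_le_of_le_one_left (by positivity) (xi_le _ _ _)
  change _ + (_ + (_ + (_ + (_ + (_ + (_ + (_ + (_ + (_ + (_ + _)))))))))) = _ at h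
  set SC := ∑ i, xi ρ k (.Jc i) * ((z:ℤ) + ((i : Fin (z+1)).val : ℤ)) with hSC
  set SG := ∑ i, xi ρ k (.Jγ i) * (3*z - (((i : Fin z).val:ℤ)+1)) with hSG
  set SD := ∑ i, xi ρ k (.Jδ i) * (3*z - (((i : Fin z).val:ℤ)+1)) with hSD
  set SP := ∑ i, xi ρ k (.Jpart i) * (ι i : ℤ) with hSP
  have hfold : ∀ {n : ℕ} (F : Fin n → Job z), ∑ i, xi ρ k (F i) = nn ρ F k := fun _ => rfl
  simp only [hfold] at h
  have n1 := nn_nonneg ρ .JA k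
  have n2 := nn_nonneg ρ .JB k
  have n3 := nn_nonneg ρ .Ja k
  have n4 := nn_nonneg ρ .Jb k
  have n5 := nn_nonneg ρ .Jc k
  have n6 := nn_nonneg ρ .Jα k
  have n7 := nn_nonneg ρ .Jβ k
  have n8 := nn_nonneg ρ .Jγ k
  have n9 := nn_nonneg ρ .Jδ k
  have m1 := nn_le ρ .JA k
  have m2 := nn_le ρ .JB k
  have m3 := nn_le ρ .Ja k
  have m4 := nn_le ρ .Jb k
  have m5 := nn_le ρ .Jc k
  have m6 := nn_le ρ .Jα k
  have m7 := nn_le ρ .Jβ k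
  have m8 := nn_le ρ .Jγ k
  have m9 := nn_le ρ .Jδ k
  have x1 := xi_nonneg ρ k .Jl1
  have x2 := xi_nonneg ρ k .Jl2
  have y1 := xi_le ρ k .Jl1
  have y2 := xi_le ρ k .Jl2
  generalize hnA : nn ρ .JA k = nA at *
  generalize hnB : nn ρ .JB k = nB at *
  generalize hna : nn ρ .Ja k = na at *
  generalize hnb : nn ρ .Jb k = nb at *
  generalize hnc : nn ρ .Jc k = nc at *
  generalize hnα : nn ρ .Jα k = nα at *
  generalize hnβ : nn ρ .Jβ k = nβ at *
  generalize hnγ : nn ρ .Jγ k = nγ at *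
  generalize hnδ : nn ρ .Jδ k = nδ at *
  generalize hl1 : xi ρ k .Jl1 = l1 at *
  generalize hl2 : xi ρ k .Jl2 = l2 at *
  clear_value SC SG SD SP
  have hz' : (1:ℤ) ≤ z := by exact_mod_cast hz
  have hD' : 4*(z:ℤ)*(7*z+1) < D := by exact_mod_cast hD
  unfold Wval at h
  push_cast at h m1 m2 m3 m4 m5 m6 m7 m8 m9
  generalize hZ : (z:ℤ) = Z at *
  generalize hE : (D:ℤ) = E at *
  have hZZ : Z * 1 ≤ Z * Z := mul_le_mul_of_nonneg_left hz' (by linarith)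
  have hbig : 32 * Z < E := by linarith
  obtain ⟨b1l, b1u⟩ := b1
  obtain ⟨b2l, b2u⟩ := b2
  obtain ⟨b3l, b3u⟩ := b3
  have b1v : SC ≤ 2*Z*(Z+1) := le_trans b1u (mul_le_mul_of_nonneg_left m5 (by linarith))
  have b2v : SG ≤ 3*Z*Z := le_trans b2u (mul_le_mul_of_nonneg_left m8 (by linarith))
  have b3v : SD ≤ 3*Z*Z := le_trans b3u (mul_le_mul_of_nonneg_left m9 (by linarith))
  have hdig := digits E (SP - E*nγ) (nA + nβ + l2 - (Z+1)) (nB + nα + l1 - (Z+1)) (na+nβ+nδ-Z)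
    (nb+nα+nγ-Z) (na+nb-Z) (3*Z*(na+nb)+SC+4*Z*nα+(4*Z-1)*nβ+SG+SD+Z*l1+2*Z*l2 - Z*(7*Z+1))
    (nc+nα+nβ+l1+l2-(Z+1)) (by linarith)
    (by
      have q1 : E * nγ ≤ E * Z := mul_le_mul_of_nonneg_left m8 (by linarith)
      have q2 : 0 ≤ E * nγ := mul_nonneg (by linarith) n8
      have q3 : E * Z < E * E := mul_lt_mul_of_pos_left (by linarith) (by linarith)
      have q4 : E ^ 2 = E * E := sq E
      rw [abs_lt, q4]
      constructor <;> linarith)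
    (by rw [abs_lt]; constructor <;> linarith)
    (by rw [abs_lt]; constructor <;> linarith)
    (by rw [abs_lt]; constructor <;> linarith)
    (by rw [abs_lt]; constructor <;> linarith)
    (by rw [abs_lt]; constructor <;> linarith)
    (by
      have p1 : 0 ≤ Z * na := by positivity
      have p2 : 0 ≤ Z * nb := by positivity
      have p3 : 0 ≤ Z * nα := by positivity
      have p4 : 0 ≤ (4*Z-1) * nβ := mul_nonneg (by linarith) n7
      have p5 : 0 ≤ Z * l1 := by positivity
      have p6 : 0 ≤ Z * l2 := by positivity
      have q1 : Z * na ≤ Z * Z := by gcongr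
      have q2 : Z * nb ≤ Z * Z := by gcongr
      have q3 : Z * nα ≤ Z * Z := by gcongr
      have q4 : Z * nβ ≤ Z * Z := by gcongr
      have q5 : Z * l1 ≤ Z * 1 := by gcongr
      have q6 : Z * l2 ≤ Z * 1 := by gcongr
      have q7 : Z * 1 ≤ Z * Z := by gcongr
      rw [abs_lt]; constructor <;> linarith)
    (by linear_combination h)
  obtain ⟨d0, d2, d3, d4, d5, d6, d7, d8⟩ := hdig
  constructor
  · rw [hnγ, hE, ← hSP]; linarith
  · rw [hnA, hnβ, hl2, hZ]; linarith
  · rw [hnB, hnα, hl1, hZ]; linarith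
  · rw [hna, hnβ, hnδ, hZ]; linarith
  · rw [hnb, hnα, hnγ, hZ]; linarith
  · rw [hna, hnb, hZ]; linarith
  · rw [hnc, hnγ, hnδ, hna, hnb, hnα, hnβ, hl1, hl2, hZ]
    intro c0 c1 c2
    rw [c0] at b1u
    rw [c1] at b2u
    rw [c2] at b3u
    linarith
  · rw [hnc, hnα, hnβ, hl1, hl2, hZ]; linarith

theorem nn_tot {z n D q : ℕ} (ι : Fin (3*z) → ℕ) (σ : Job z → ℕ) (ρ : Job z → Finset ℕ)
    (hf : Feasible 4 (pJob z D ι) (qJob z) σ ρ) (F : Fin n → Job z) (hq : ∀ i, qJob z (F i) = q) :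
    nn ρ F 1 + nn ρ F 2 + nn ρ F 3 + nn ρ F 4 = n * q := by
  unfold nn
  rw [← Finset.sum_add_distrib, ← Finset.sum_add_distrib, ← Finset.sum_add_distrib]
  have : ∀ i, xi ρ 1 (F i) + xi ρ 2 (F i) + xi ρ 3 (F i) + xi ρ 4 (F i) = q := by
    intro i
    rw [← hq i, ← ind_sum _ _ _ _ hf (F i)]
    unfold xi
    push_cast
    rfl
  simp [this]

theorem part_zero {z D : ℕ} (ι : Fin (3*z) → ℕ) (hpos : ∀ i, 0 < ι i) (ρ : Job z → Finset ℕ) (k : ℕ)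
    (he : Eqs D ι ρ k) (h : nn ρ .Jγ k = 0) (i : Fin (3*z)) : k ∉ ρ (.Jpart i) := by
  intro hc
  have h0 := he.e0
  rw [h, mul_zero] at h0
  have := (Finset.sum_eq_zero_iff_of_nonneg
    (fun i _ => mul_nonneg (xi_nonneg ρ k (.Jpart i)) (by positivity))).1 h0 i (Finset.mem_univ _)
  have hp := hpos i
  simp [xi, hc] at this
  omega

theorem normal_of_l1 {z D : ℕ} (ι : Fin (3*z) → ℕ) (hz : 0 < z)
    (hpos : ∀ i, 0 < ι i) (σ : Job z → ℕ) (ρ : Job z → Finset ℕ)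
    (hf : Feasible 4 (pJob z D ι) (qJob z) σ ρ)
    (E : ∀ k, k ∈ Finset.Icc 1 4 → Eqs D ι ρ k)
    (h3 : ∀ j, qJob z j = 3 → 2 ∈ ρ j ∧ 3 ∈ ρ j) (h1 : 4 ∉ ρ .Jl1) : NormalForm ρ := by
  have E1 := E 1 (by decide)
  have E2 := E 2 (by decide)
  have E3 := E 3 (by decide)
  have E4 := E 4 (by decide)
  have A2 := nn_of_full ρ .JA 2 (fun i => (h3 _ rfl).1)
  have A3 := nn_of_full ρ .JA 3 (fun i => (h3 _ rfl).2)
  have B2 := nn_of_full ρ .JB 2 (fun i => (h3 _ rfl).1)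
  have B3 := nn_of_full ρ .JB 3 (fun i => (h3 _ rfl).2)
  have tA := nn_tot ι σ ρ hf .JA (q := 3) (fun _ => rfl)
  have tB := nn_tot ι σ ρ hf .JB (q := 3) (fun _ => rfl)
  have ta := nn_tot ι σ ρ hf .Ja (q := 2) (fun _ => rfl)
  have tb := nn_tot ι σ ρ hf .Jb (q := 2) (fun _ => rfl)
  have tc := nn_tot ι σ ρ hf .Jc (q := 2) (fun _ => rfl)
  have tα := nn_tot ι σ ρ hf .Jα (q := 1) (fun _ => rfl)
  have tβ := nn_tot ι σ ρ hf .Jβ (q := 1) (fun _ => rfl)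
  have tγ := nn_tot ι σ ρ hf .Jγ (q := 1) (fun _ => rfl)
  have tδ := nn_tot ι σ ρ hf .Jδ (q := 1) (fun _ => rfl)
  have l4 : xi ρ 4 .Jl1 = 0 := by simp [xi, h1]
  have tl1 : xi ρ 1 .Jl1 + xi ρ 2 .Jl1 + xi ρ 3 .Jl1 + xi ρ 4 .Jl1 = 1 := by
    have := ind_sum _ _ _ _ hf (.Jl1 : Job z)
    unfold xi
    exact_mod_cast this
  have tl2 : xi ρ 1 .Jl2 + xi ρ 2 .Jl2 + xi ρ 3 .Jl2 + xi ρ 4 .Jl2 = 1 := by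
    have := ind_sum _ _ _ _ hf (.Jl2 : Job z)
    unfold xi
    exact_mod_cast this
  have P := fun k {n : ℕ} (F : Fin n → Job z) => nn_nonneg ρ F k
  have X := fun k (j : Job z) => xi_nonneg ρ k j
  push_cast at *
  have f1 : nn ρ .Jβ 2 = 0 := by linarith [E2.e2, P 2 .Jβ, X 2 .Jl2]
  have f2 : xi ρ 2 .Jl2 = 0 := by linarith [E2.e2, P 2 .Jβ, X 2 .Jl2]
  have f3 : nn ρ .Jβ 3 = 0 := by linarith [E3.e2, P 3 .Jβ, X 3 .Jl2]
  have f4 : xi ρ 3 .Jl2 = 0 := by linarith [E3.e2, P 3 .Jβ, X 3 .Jl2]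
  have f5 : nn ρ .Jα 2 = 0 := by linarith [E2.e3, P 2 .Jα, X 2 .Jl1]
  have f6 : xi ρ 2 .Jl1 = 0 := by linarith [E2.e3, P 2 .Jα, X 2 .Jl1]
  have f7 : nn ρ .Jα 3 = 0 := by linarith [E3.e3, P 3 .Jα, X 3 .Jl1]
  have f8 : xi ρ 3 .Jl1 = 0 := by linarith [E3.e3, P 3 .Jα, X 3 .Jl1]
  have c2 : nn ρ .Jc 2 = z + 1 := by linarith [E2.e8]
  have c3 : nn ρ .Jc 3 = z + 1 := by linarith [E3.e8]
  have c1 : nn ρ .Jc 1 = 0 := by linarith [P 1 .Jc, P 4 .Jc]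
  have c4 : nn ρ .Jc 4 = 0 := by linarith [P 1 .Jc, P 4 .Jc]
  have l1 : xi ρ 1 .Jl1 = 1 := by linarith
  have hs1 : nn ρ .Jα 1 + nn ρ .Jβ 1 + nn ρ .Jγ 1 + nn ρ .Jδ 1 = z := by
    linarith [E1.e4, E1.e5, E1.e6]
  have hs4 : nn ρ .Jα 4 + nn ρ .Jβ 4 + nn ρ .Jγ 4 + nn ρ .Jδ 4 = z := by
    linarith [E4.e4, E4.e5, E4.e6]
  have g1 : nn ρ .Jγ 1 = 0 := by linarith [P 1 .Jγ, P 4 .Jγ, P 1 .Jδ, P 4 .Jδ]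
  have g4 : nn ρ .Jγ 4 = 0 := by linarith [P 1 .Jγ, P 4 .Jγ, P 1 .Jδ, P 4 .Jδ]
  have d1 : nn ρ .Jδ 1 = 0 := by linarith [P 1 .Jγ, P 4 .Jγ, P 1 .Jδ, P 4 .Jδ]
  have d4 : nn ρ .Jδ 4 = 0 := by linarith [P 1 .Jγ, P 4 .Jγ, P 1 .Jδ, P 4 .Jδ]
  have l21 : xi ρ 1 .Jl2 = 0 := by linarith [E1.e8]
  have l24 : xi ρ 4 .Jl2 = 1 := by linarith
  have β1 : nn ρ .Jβ 1 = 0 := by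
    have h := E1.e7 c1 g1 d1
    rw [E1.e6, l1, l21] at h
    have hα : nn ρ .Jα 1 = z - nn ρ .Jβ 1 := by linarith
    rw [hα] at h
    linarith
  have α1 : nn ρ .Jα 1 = z := by linarith
  have a1 : nn ρ .Ja 1 = z := by linarith [E1.e4]
  have b1 : nn ρ .Jb 1 = 0 := by linarith [E1.e6]
  have A1 : nn ρ .JA 1 = z + 1 := by linarith [E1.e2]
  have B1 : nn ρ .JB 1 = 0 := by linarith [E1.e3]
  have β4 : nn ρ .Jβ 4 = z := by linarith
  have α4 : nn ρ .Jα 4 = 0 := by linarith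
  have a4 : nn ρ .Ja 4 = 0 := by linarith [E4.e4]
  have b4 : nn ρ .Jb 4 = z := by linarith [E4.e6]
  have A4 : nn ρ .JA 4 = 0 := by linarith [E4.e2]
  have B4 : nn ρ .JB 4 = z + 1 := by linarith [E4.e3]
  have l1' : 1 ∈ ρ .Jl1 := by
    by_contra h; simp [xi, h] at l1
  have l24' : 4 ∈ ρ .Jl2 := by
    by_contra h; simp [xi, h] at l24
  have l21' : 1 ∉ ρ .Jl2 := by
    intro h; simp [xi, h] at l21
  have n1 : ∀ j, 1 ∈ ρ j ↔ M1Jobs j := by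
    intro j
    cases j with
    | JA i => exact iff_of_true (nn_full ρ .JA 1 (by push_cast; exact A1) i) trivial
    | JB i => exact iff_of_false (nn_zero ρ .JB 1 B1 i) id
    | Ja i => exact iff_of_true (nn_full ρ .Ja 1 a1 i) trivial
    | Jb i => exact iff_of_false (nn_zero ρ .Jb 1 b1 i) id
    | Jc i => exact iff_of_false (nn_zero ρ .Jc 1 c1 i) id
    | Jα i => exact iff_of_true (nn_full ρ .Jα 1 α1 i) trivial
    | Jβ i => exact iff_of_false (nn_zero ρ .Jβ 1 β1 i) id
    | Jγ i => exact iff_of_false (nn_zero ρ .Jγ 1 g1 i) id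
    | Jδ i => exact iff_of_false (nn_zero ρ .Jδ 1 d1 i) id
    | Jl1 => exact iff_of_true l1' trivial
    | Jl2 => exact iff_of_false l21' id
    | Jpart i => exact iff_of_false (part_zero ι hpos ρ 1 E1 g1 i) id
  have n4 : ∀ j, 4 ∈ ρ j ↔ M4Jobs j := by
    intro j
    cases j with
    | JB i => exact iff_of_true (nn_full ρ .JB 4 (by push_cast; exact B4) i) trivial
    | JA i => exact iff_of_false (nn_zero ρ .JA 4 A4 i) id
    | Jb i => exact iff_of_true (nn_full ρ .Jb 4 b4 i) trivial
    | Ja i => exact iff_of_false (nn_zero ρ .Ja 4 a4 i) id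
    | Jc i => exact iff_of_false (nn_zero ρ .Jc 4 c4 i) id
    | Jβ i => exact iff_of_true (nn_full ρ .Jβ 4 β4 i) trivial
    | Jα i => exact iff_of_false (nn_zero ρ .Jα 4 α4 i) id
    | Jγ i => exact iff_of_false (nn_zero ρ .Jγ 4 g4 i) id
    | Jδ i => exact iff_of_false (nn_zero ρ .Jδ 4 d4 i) id
    | Jl2 => exact iff_of_true l24' trivial
    | Jl1 => exact iff_of_false h1 id
    | Jpart i => exact iff_of_false (part_zero ι hpos ρ 4 E4 g4 i) id
  refine ⟨n1, n4, ?_, ?_⟩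
  · intro j hj
    cases j with
    | JA i => exact h3 _ rfl
    | JB i => exact h3 _ rfl
    | Jc i => exact ⟨nn_full ρ .Jc 2 (by push_cast; exact c2) i, nn_full ρ .Jc 3 (by push_cast; exact c3) i⟩
    | _ => exact absurd hj id
  · intro j hj
    have hs := ind_sum _ _ _ _ hf j
    have k1 := n1 j
    have k4 := n4 j
    cases j <;> first
      | exact absurd hj id
      | (simp only [k1, k4, M1Jobs, M4Jobs, qJob, if_true, if_false] at hs
         split_ifs at hs with p2 p3 p3 <;> first | omega | simp [p2, p3])

theorem nn_card {z n : ℕ} (ρ : Job z → Finset ℕ) (F : Fin n → Job z) (hF : Function.Injective F) (k : ℕ) :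
    (((Finset.univ.image F).filter (fun j => k ∈ ρ j)).card : ℤ) = nn ρ F k := by
  rw [Finset.card_filter, Finset.sum_image (fun a _ b _ h => hF h)]
  unfold nn xi
  push_cast
  rfl

/-- A feasible schedule with makespan `W` can be brought into normal form; moreover in
every normal-form feasible schedule with makespan `W`, machine 2 processes as many jobs
of `a` as of `γ`, and as many jobs of `b` as of `δ`. -/
theorem normal_form_exists_and_counts
    (z D : ℕ) (ι : Fin (3*z) → ℕ)
    (hz : 0 < z) (hDpos : 0 < D)
    (hιpos : ∀ i, 0 < ι i)
    (hsum : ∑ i, ι i = z * D)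
    (hlow : ∀ i, D < 4 * ι i)
    (hhigh : ∀ i, 2 * ι i < D)
    (hD : 4*z*(7*z+1) < D) :
    ((∃ (σ : Job z → ℕ) (ρ : Job z → Finset ℕ),
        Feasible 4 (pJob z D ι) (qJob z) σ ρ ∧
        makespan (pJob z D ι) σ = Wval z D) →
      ∃ (σ : Job z → ℕ) (ρ : Job z → Finset ℕ),
        Feasible 4 (pJob z D ι) (qJob z) σ ρ ∧
        makespan (pJob z D ι) σ = Wval z D ∧ NormalForm ρ) ∧
    (∀ (σ : Job z → ℕ) (ρ : Job z → Finset ℕ),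
        Feasible 4 (pJob z D ι) (qJob z) σ ρ →
        makespan (pJob z D ι) σ = Wval z D → NormalForm ρ →
        ((sa z).filter (fun j => 2 ∈ ρ j)).card =
          ((sγ z).filter (fun j => 2 ∈ ρ j)).card ∧
        ((sb z).filter (fun j => 2 ∈ ρ j)).card =
          ((sδ z).filter (fun j => 2 ∈ ρ j)).card) := by
  constructor
  · rintro ⟨σ, ρ, hf, hm⟩
    obtain ⟨ρ, hf, h3⟩ := three_main _ _ σ ρ hf (by
      intro j hj
      cases j <;> simp only [qJob] at hj <;> first | omega | (simp only [pJob]; positivity))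
    by_cases h4 : 4 ∈ ρ .Jl1
    · have hf' := tail_swap _ _ σ ρ hf 0 (Equiv.swap 1 4) (by decide) (by
        intro k _ _ j _ h; omega)
      simp only [Nat.not_lt_zero, if_false] at hf'
      have hsym : ∀ k j, k ∈ (ρ j).map (Equiv.swap 1 4).toEmbedding ↔ Equiv.swap 1 4 k ∈ ρ j := by
        intro k j
        rw [Finset.mem_map_equiv, Equiv.symm_swap]
      refine ⟨σ, _, hf', hm, normal_of_l1 ι hz hιpos σ _ hf'
        (fun k hk => eqs_main ι hz hDpos hsum hD σ _ hf' hm k hk) ?_ ?_⟩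
      · intro j hj
        rw [hsym, hsym]
        exact h3 j hj
      · rw [hsym, Equiv.swap_apply_right]
        have hs := ind_sum _ _ _ _ hf (.Jl1 : Job z)
        intro h1
        simp only [h1, h4, if_true, qJob] at hs
        omega
    · exact ⟨σ, ρ, hf, hm, normal_of_l1 ι hz hιpos σ ρ hf
        (fun k hk => eqs_main ι hz hDpos hsum hD σ ρ hf hm k hk) h3 h4⟩
  · intro σ ρ hf hm hN
    have E := eqs_main ι hz hDpos hsum hD σ ρ hf hm 2 (by decide)
    have ca := nn_card ρ Job.Ja (fun a b h => by injection h) 2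
    have cb := nn_card ρ Job.Jb (fun a b h => by injection h) 2
    have cγ := nn_card ρ Job.Jγ (fun a b h => by injection h) 2
    have cδ := nn_card ρ Job.Jδ (fun a b h => by injection h) 2
    have A2 := nn_of_full ρ .JA 2 (fun i => (hN.2.2.1 (.JA i) trivial).1)
    have B2 := nn_of_full ρ .JB 2 (fun i => (hN.2.2.1 (.JB i) trivial).1)
    have p1 := nn_nonneg ρ .Jα 2
    have p2 := nn_nonneg ρ .Jβ 2
    have p3 := xi_nonneg ρ 2 .Jl1
    have p4 := xi_nonneg ρ 2 .Jl2
    have e2 := E.e2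
    have e3 := E.e3
    have e4 := E.e4
    have e5 := E.e5
    have e6 := E.e6
    push_cast at A2 B2
    unfold sa sb sγ sδ
    constructor <;> zify <;> linarith
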